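/- arXiv:math/0601609 — 2 statements merged into one kernel-verified Lean document; each statement's English description precedes it below -/
import Mathlib

section
/- For every nonnegative real number s and every ε > 0, there exists a constant K > 0 such that for all functions f : ℝ → ℂ that are 2π-periodic, ([s+1/2+ε])-times continuously differentiable, with ([s̃])-th derivative Hölder continuous of exponent s̃ - [s̃] (where s̃ = s + 1/2 + ε and [·] denotes the floor), the Fourier coefficients of f satisfy ∑_{n ∈ ℤ} |f̂(n)| (1+|n|)^s ≤ K ‖f‖_{Λ_{s̃}}, where ‖f‖_{Λ_{s̃}} is the sum of the C^{[s̃]} norm and the Hölder seminorm of the [s̃]-th derivative. -/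
open Real MeasureTheory

/-- Fourier coefficient of a `2π`-periodic function `f : ℝ → ℂ`. -/
noncomputable def fourierCoeffR (f : ℝ → ℂ) (n : ℤ) : ℂ :=
  (1 / (2 * Real.pi)) * ∫ t in (0:ℝ)..(2 * Real.pi), f t * Complex.exp (-(n : ℂ) * t * Complex.I)

theorem bern_bessel (u : ℝ → ℂ) (hu : Continuous u) (M : ℝ) (hM : ∀ t, ‖u t‖ ≤ M)
    (B : Finset ℤ) : ∑ n ∈ B, ‖fourierCoeffR u n‖ ^ 2 ≤ M ^ 2 := by
  have hab : (0:ℝ) < 2 * Real.pi := by positivity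
  have hL : MemLp u 2 (volume.restrict (Set.Ioc 0 (2 * Real.pi))) :=
    MemLp.of_bound hu.aestronglyMeasurable M (Filter.Eventually.of_forall hM)
  have h := hasSum_sq_fourierCoeffOn hab hL
  have he : ∀ n, fourierCoeffR u n = fourierCoeffOn hab u n := by
    intro n
    rw [fourierCoeffOn_eq_integral, fourierCoeffR]
    simp only [sub_zero, fourier_coe_apply, smul_eq_mul, Complex.real_smul]
    push_cast
    congr 1
    apply intervalIntegral.integral_congr
    intro x _
    simp only
    rw [mul_comm]
    congr 2
    have : (Real.pi : ℂ) ≠ 0 := by exact_mod_cast Real.pi_ne_zero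
    field_simp
  simp_rw [he]
  refine (sum_le_hasSum B (fun _ _ => by positivity) h).trans ?_
  have h2 : ∫ x in (0:ℝ)..(2 * Real.pi), ‖u x‖ ^ 2 ≤ ∫ x in (0:ℝ)..(2 * Real.pi), M ^ 2 := by
    apply intervalIntegral.integral_mono_on hab.le
    · exact (by fun_prop : Continuous fun x => ‖u x‖ ^ 2).intervalIntegrable _ _
    · exact continuous_const.intervalIntegrable _ _
    · intro x _
      exact pow_le_pow_left₀ (norm_nonneg _) (hM x) 2
  rw [intervalIntegral.integral_const] at h2
  simp only [sub_zero, smul_eq_mul] at h2 ⊢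
  rw [inv_mul_le_iff₀ hab]
  exact h2

theorem bern_deriv (f f' : ℝ → ℂ) (hp : Function.Periodic f (2 * Real.pi))
    (hd : ∀ x, HasDerivAt f (f' x) x) (hc : Continuous f') (n : ℤ) :
    fourierCoeffR f' n = (n * Complex.I) * fourierCoeffR f n := by
  have hv : ∀ x : ℝ, HasDerivAt (fun t : ℝ => Complex.exp (-(n : ℂ) * t * Complex.I))
      (Complex.exp (-(n : ℂ) * x * Complex.I) * (-(n : ℂ) * 1 * Complex.I)) x := by
    intro x
    exact (((hasDerivAt_id (x:ℂ)).const_mul (-(n:ℂ))).mul_const Complex.I).cexp.comp_ofReal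
  have h := intervalIntegral.integral_mul_deriv_eq_deriv_mul (a := 0) (b := 2 * Real.pi)
    (u := f) (u' := f') (fun x _ => hd x) (fun x _ => hv x) (hc.intervalIntegrable _ _)
    ((by fun_prop : Continuous fun x : ℝ => Complex.exp (-(n : ℂ) * x * Complex.I) *
      (-(n : ℂ) * 1 * Complex.I)).intervalIntegrable _ _)
  have h0 : f (2 * Real.pi) = f 0 := by simpa using hp 0
  have h1 : Complex.exp (-(n : ℂ) * ((2 * Real.pi : ℝ) : ℂ) * Complex.I) = 1 := by
    rw [Complex.exp_eq_one_iff]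
    exact ⟨-n, by push_cast; ring⟩
  simp only [h0, h1] at h
  have h2 : (fun x : ℝ => f x * (Complex.exp (-(n : ℂ) * x * Complex.I) *
      (-(n : ℂ) * 1 * Complex.I))) = fun x : ℝ => (f x * Complex.exp (-(n : ℂ) * x * Complex.I)) *
      (-(n : ℂ) * 1 * Complex.I) := by
    funext x; ring
  rw [h2, intervalIntegral.integral_mul_const] at h
  simp only [Complex.ofReal_zero, mul_zero, zero_mul, Complex.exp_zero, mul_one, sub_self,
    zero_sub] at h
  unfold fourierCoeffR
  linear_combination (1 / (2 * (Real.pi:ℂ))) * h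

theorem bern_iter (f : ℝ → ℂ) (m : ℕ) (hp : Function.Periodic f (2 * Real.pi))
    (hf : ContDiff ℝ m f) (n : ℤ) : ∀ k ≤ m,
    Function.Periodic (iteratedDeriv k f) (2 * Real.pi) ∧
    ‖fourierCoeffR (iteratedDeriv k f) n‖ = |(n:ℝ)| ^ k * ‖fourierCoeffR f n‖ := by
  intro k
  induction k with
  | zero => intro _; simpa using hp
  | succ k ih =>
    intro hk
    obtain ⟨h1, h2⟩ := ih (by omega)
    constructor
    · intro x
      have := iteratedDeriv_comp_add_const (n := k + 1) (f := f) (s := 2 * Real.pi) (𝕜 := ℝ)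
      have h3 : (fun z => f (z + 2 * Real.pi)) = f := funext hp
      rw [h3] at this
      exact (congrFun this x).symm
    · rw [bern_deriv (iteratedDeriv k f) (iteratedDeriv (k+1) f) h1, norm_mul, h2, pow_succ]
      · simp; ring
      · intro x
        rw [iteratedDeriv_succ]
        exact ((hf.differentiable_iteratedDeriv k (by exact_mod_cast hk)) x).hasDerivAt
      · exact hf.continuous_iteratedDeriv (k+1) (by exact_mod_cast hk)

theorem bern_shift (g : ℝ → ℂ) (hp : Function.Periodic g (2 * Real.pi)) (hc : Continuous g)
    (h : ℝ) (n : ℤ) :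
    fourierCoeffR (fun t => g (t + h) - g t) n =
      (Complex.exp (Complex.I * ((n * h : ℝ):ℂ)) - 1) * fourierCoeffR g n := by
  unfold fourierCoeffR
  have hP : Function.Periodic (fun t : ℝ => g t * Complex.exp (-(n : ℂ) * t * Complex.I))
      (2 * Real.pi) := by
    intro x
    simp only [hp x]
    congr 1
    rw [Complex.exp_eq_exp_iff_exists_int]
    exact ⟨-n, by push_cast; ring⟩
  have e1 := intervalIntegral.integral_comp_add_right
    (fun t : ℝ => g t * Complex.exp (-(n : ℂ) * t * Complex.I)) h (a := 0) (b := 2 * Real.pi)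
  have e2 := hP.intervalIntegral_add_eq 0 h
  rw [zero_add, add_comm (2 * Real.pi) h, ← e2, zero_add] at e1
  have e3 : (fun t : ℝ => (g (t + h) - g t) * Complex.exp (-(n : ℂ) * t * Complex.I)) =
    fun t : ℝ => Complex.exp (Complex.I * ((n * h : ℝ):ℂ)) *
      (g (t + h) * Complex.exp (-(n : ℂ) * ((t + h : ℝ) : ℂ) * Complex.I)) -
      g t * Complex.exp (-(n : ℂ) * t * Complex.I) := by
    funext t
    have : Complex.exp (-(n : ℂ) * t * Complex.I) = Complex.exp (Complex.I * ((n * h : ℝ):ℂ)) *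
        Complex.exp (-(n : ℂ) * ((t + h : ℝ) : ℂ) * Complex.I) := by
      rw [← Complex.exp_add]; congr 1; push_cast; ring
    rw [sub_mul]
    congr 1
    rw [this]; ring
  rw [e3, intervalIntegral.integral_sub, intervalIntegral.integral_const_mul, e1]
  · ring
  · exact Continuous.intervalIntegrable (by fun_prop) _ _
  · exact Continuous.intervalIntegrable (by fun_prop) _ _

theorem bern_exp (j : ℕ) (n : ℤ) (h1 : 2 ^ j ≤ n.natAbs) (h2 : n.natAbs < 2 ^ (j+1)) :
    1 ≤ ‖Complex.exp (Complex.I * ((n * (Real.pi / 2 ^ (j+1)) : ℝ):ℂ)) - 1‖ := by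
  rw [Complex.norm_exp_I_mul_ofReal_sub_one, Real.norm_eq_abs, abs_mul, abs_two]
  have h1' : (2:ℝ) ^ j ≤ |(n:ℝ)| := by
    rw [← Int.cast_abs, Int.abs_eq_natAbs]; exact_mod_cast h1
  have h2' : |(n:ℝ)| < (2:ℝ) ^ (j+1) := by
    rw [← Int.cast_abs, Int.abs_eq_natAbs]; exact_mod_cast h2
  have hp := Real.pi_pos
  set x := |(n:ℝ)| * (Real.pi / 2 ^ (j+1)) / 2 with hx
  have e : |Real.sin ((n * (Real.pi / 2 ^ (j+1)) : ℝ) / 2)| = |Real.sin x| := by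
    rcases abs_cases (n:ℝ) with ⟨h, _⟩ | ⟨h, _⟩
    · rw [hx, h]
    · rw [hx, h, neg_mul, neg_div, Real.sin_neg, abs_neg]
  rw [e]
  have hq : (0:ℝ) < 2 ^ j := by positivity
  have x1 : Real.pi / 6 ≤ x := by
    have : Real.pi / 4 ≤ x := by
      rw [hx, pow_succ]
      calc Real.pi / 4 = 2 ^ j * (Real.pi / (2 ^ j * 2)) / 2 := by field_simp; norm_num
        _ ≤ _ := by gcongr
    linarith
  have x2 : x ≤ Real.pi / 2 := by
    rw [hx]
    calc _ ≤ 2 ^ (j+1) * (Real.pi / 2 ^ (j+1)) / 2 := by gcongr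
      _ = _ := by field_simp
  have := Real.sin_le_sin_of_le_of_le_pi_div_two (by linarith) x2 x1
  rw [Real.sin_pi_div_six] at this
  have := le_abs_self (Real.sin x)
  linarith

theorem bern_block (g : ℝ → ℂ) (hp : Function.Periodic g (2 * Real.pi)) (hc : Continuous g)
    (M α : ℝ) (hM : 0 ≤ M) (ha : 0 ≤ α) (ha1 : α ≤ 1)
    (hg : ∀ t t' : ℝ, ‖g t - g t'‖ ≤
      M * ‖Complex.exp (t * Complex.I) - Complex.exp (t' * Complex.I)‖ ^ α)
    (j : ℕ) (B : Finset ℤ) (hB : ∀ n ∈ B, 2 ^ j ≤ n.natAbs ∧ n.natAbs < 2 ^ (j+1)) :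
    ∑ n ∈ B, ‖fourierCoeffR g n‖ ≤ 6 * M * (2:ℝ) ^ ((j:ℝ) * (1/2 - α)) := by
  set h : ℝ := Real.pi / 2 ^ (j+1) with hh
  have hpos : 0 < h := by positivity
  have hh2 : h ≤ 2 * (2:ℝ) ^ (-(j:ℝ)) := by
    rw [Real.rpow_neg (by norm_num), Real.rpow_natCast, hh, pow_succ, div_le_iff₀ (by positivity)]
    have := Real.pi_le_four
    have e : 2 * ((2:ℝ) ^ j)⁻¹ * (2 ^ j * 2) = 4 := by field_simp; norm_num
    rw [e]; exact this
  have hha : h ^ α ≤ 2 * (2:ℝ) ^ (-((j:ℝ) * α)) := by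
    calc h ^ α ≤ (2 * (2:ℝ) ^ (-(j:ℝ))) ^ α := Real.rpow_le_rpow hpos.le hh2 ha
      _ = 2 ^ α * (2:ℝ) ^ (-((j:ℝ) * α)) := by
        rw [Real.mul_rpow (by norm_num) (by positivity), ← Real.rpow_mul (by norm_num), neg_mul]
      _ ≤ 2 * (2:ℝ) ^ (-((j:ℝ) * α)) := by
        gcongr
        calc (2:ℝ) ^ α ≤ 2 ^ (1:ℝ) := Real.rpow_le_rpow_of_exponent_le (by norm_num) ha1
          _ = 2 := by simp
  have hu : ∀ t, ‖g (t + h) - g t‖ ≤ M * (2 * (2:ℝ) ^ (-((j:ℝ) * α))) := by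
    intro t
    refine (hg _ _).trans ?_
    refine mul_le_mul_of_nonneg_left (le_trans ?_ hha) hM
    refine Real.rpow_le_rpow (norm_nonneg _) ?_ ha
    have e : Complex.exp ((t + h : ℝ) * Complex.I) - Complex.exp (t * Complex.I) =
        Complex.exp (t * Complex.I) * (Complex.exp (Complex.I * h) - 1) := by
      rw [mul_sub, ← Complex.exp_add, mul_one]; congr 2; push_cast; ring
    rw [e, norm_mul, Complex.norm_exp_ofReal_mul_I, one_mul]
    refine Real.norm_exp_I_mul_ofReal_sub_one_le.trans ?_
    rw [Real.norm_of_nonneg hpos.le]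
  have hb := bern_bessel (fun t => g (t + h) - g t) (by fun_prop) _ hu B
  have hb2 : ∑ n ∈ B, ‖fourierCoeffR g n‖ ^ 2 ≤ (M * (2 * (2:ℝ) ^ (-((j:ℝ) * α)))) ^ 2 := by
    refine le_trans (Finset.sum_le_sum fun n hn => ?_) hb
    rw [bern_shift g hp hc, norm_mul]
    refine pow_le_pow_left₀ (norm_nonneg _) ?_ 2
    exact le_mul_of_one_le_left (norm_nonneg _) (bern_exp j n (hB n hn).1 (hB n hn).2)
  have hcard : (B.card : ℝ) ≤ 2 ^ j * 9 := by
    have : B ⊆ Finset.Icc (-(2 ^ (j+1) : ℤ)) (2 ^ (j+1)) := by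
      intro n hn
      have := (hB n hn).2
      have h3 : (n.natAbs : ℤ) < 2 ^ (j+1) := by exact_mod_cast this
      rw [Finset.mem_Icc]; omega
    have h4 := Finset.card_le_card this
    rw [Int.card_Icc] at h4
    have h5 : (B.card : ℤ) ≤ 2 ^ j * 9 := by
      have : (1:ℤ) ≤ 2 ^ j := one_le_pow₀ (by norm_num)
      rw [pow_succ] at h4
      omega
    exact_mod_cast h5
  have hcs := sq_sum_le_card_mul_sum_sq (s := B) (f := fun n => ‖fourierCoeffR g n‖)
  refine (le_abs_self _).trans (abs_le_of_sq_le_sq ?_ (by positivity))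
  refine hcs.trans ?_
  calc _ ≤ (2 ^ j * 9) * (M * (2 * (2:ℝ) ^ (-((j:ℝ) * α)))) ^ 2 := by
        gcongr
    _ = (6 * M * (2:ℝ) ^ ((j:ℝ) * (1/2 - α))) ^ 2 := by
        have e1 : (2:ℝ) ^ ((j:ℝ) * (1/2 - α)) = 2 ^ ((j:ℝ)/2) * (2:ℝ) ^ (-((j:ℝ) * α)) := by
          rw [← Real.rpow_add (by norm_num)]; congr 1; ring
        have e2 : ((2:ℝ) ^ ((j:ℝ)/2)) ^ 2 = 2 ^ j := by
          rw [← Real.rpow_natCast, ← Real.rpow_mul (by norm_num), ← Real.rpow_natCast]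
          congr 1; push_cast; ring
        rw [e1, ← e2]; ring

/-- Bernstein-type embedding `Λ_{s+1/2+ε}(𝕋) ↪ A_s(𝕋)`. -/
theorem stmt0 (s ε : ℝ) (hs : 0 ≤ s) (hε : 0 < ε) :
    ∃ K > 0, ∀ (f : ℝ → ℂ) (M₁ M₂ : ℝ),
      Function.Periodic f (2 * Real.pi) →
      ContDiff ℝ (⌊s + 1/2 + ε⌋₊ : ℕ) f →
      (∀ k ≤ ⌊s + 1/2 + ε⌋₊, ∀ t : ℝ, ‖iteratedDeriv k f t‖ ≤ M₁) →
      (∀ t t' : ℝ,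
        ‖iteratedDeriv ⌊s + 1/2 + ε⌋₊ f t - iteratedDeriv ⌊s + 1/2 + ε⌋₊ f t'‖ ≤
          M₂ * ‖Complex.exp (t * Complex.I) - Complex.exp (t' * Complex.I)‖ ^
            ((s + 1/2 + ε) - (⌊s + 1/2 + ε⌋₊ : ℝ))) →
      ∑' n : ℤ, ‖fourierCoeffR f n‖ * (1 + |(n : ℝ)|) ^ s ≤ K * (M₁ + M₂) := by
  set σ := s + 1/2 + ε with hσ
  set m := ⌊σ⌋₊ with hm
  have hσ0 : 0 ≤ σ := by positivity
  have ha0 : 0 ≤ σ - m := sub_nonneg.2 (Nat.floor_le hσ0)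
  have ha1 : σ - m ≤ 1 := by have := Nat.lt_floor_add_one σ; linarith
  set r : ℝ := (2:ℝ) ^ (-ε) with hr
  have hr0 : 0 < r := by positivity
  have hr1 : r < 1 := Real.rpow_lt_one_of_one_lt_of_neg (by norm_num) (by linarith)
  have hr2 : 0 < 1 - r := by linarith
  refine ⟨1 + (2:ℝ) ^ s * 6 / (1 - r), by positivity, ?_⟩
  intro f M₁ M₂ hp hf hb hH
  have hM1 : 0 ≤ M₁ := (norm_nonneg _).trans (hb 0 (Nat.zero_le _) 0)
  have hM2 : 0 ≤ M₂ := by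
    have h := (norm_nonneg _).trans (hH Real.pi 0)
    have e : ‖Complex.exp (Real.pi * Complex.I) - Complex.exp ((0:ℝ) * Complex.I)‖ = 2 := by
      rw [Complex.exp_pi_mul_I]; norm_num
    rw [e] at h
    exact nonneg_of_mul_nonneg_left h (by positivity)
  have hgp : Function.Periodic (iteratedDeriv m f) (2 * Real.pi) :=
    (bern_iter f m hp hf 0 m le_rfl).1
  have hgc : Continuous (iteratedDeriv m f) := hf.continuous_iteratedDeriv m le_rfl
  have hblock := bern_block (iteratedDeriv m f) hgp hgc M₂ (σ - m) hM2 ha0 ha1 hH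
  have hzero : ‖fourierCoeffR f 0‖ ≤ M₁ := by
    have h := bern_bessel f hf.continuous M₁ (by simpa using hb 0 (Nat.zero_le _)) {0}
    rw [Finset.sum_singleton] at h
    exact (le_abs_self _).trans (abs_le_of_sq_le_sq h hM1)
  set a : ℤ → ℝ := fun n => ‖fourierCoeffR f n‖ * (1 + |(n : ℝ)|) ^ s with hadef
  have hann : ∀ n, 0 ≤ a n := fun n => by positivity
  have hB : ∀ (j : ℕ) (B : Finset ℤ), (∀ n ∈ B, 2 ^ j ≤ n.natAbs ∧ n.natAbs < 2 ^ (j+1)) →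
      ∑ n ∈ B, a n ≤ (2:ℝ) ^ s * 6 * M₂ * r ^ j := by
    intro j B hBj
    have hterm : ∀ n ∈ B, a n ≤
        (2:ℝ) ^ s * (2:ℝ) ^ ((j:ℝ) * (s - m)) * ‖fourierCoeffR (iteratedDeriv m f) n‖ := by
      intro n hn
      obtain ⟨h1, h2⟩ := hBj n hn
      have h1' : (2:ℝ) ^ j ≤ |(n:ℝ)| := by
        rw [← Int.cast_abs, Int.abs_eq_natAbs]; exact_mod_cast h1
      have h2' : 1 + |(n:ℝ)| ≤ (2:ℝ) ^ (j+1) := by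
        rw [← Int.cast_abs, Int.abs_eq_natAbs]
        have : 1 + n.natAbs ≤ 2 ^ (j+1) := by omega
        exact_mod_cast this
      rw [(bern_iter f m hp hf n m le_rfl).2]
      have e1 : (1 + |(n:ℝ)|) ^ s ≤ (2:ℝ) ^ s * 2 ^ ((j:ℝ) * s) := by
        calc (1 + |(n:ℝ)|) ^ s ≤ ((2:ℝ) ^ (j+1)) ^ s := Real.rpow_le_rpow (by positivity) h2' hs
          _ = _ := by
            rw [pow_succ, Real.mul_rpow (by positivity) (by norm_num), mul_comm,
              ← Real.rpow_natCast, ← Real.rpow_mul (by norm_num)]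
      have e2 : (2:ℝ) ^ ((j:ℝ) * s) ≤ (2:ℝ) ^ ((j:ℝ) * (s - m)) * |(n:ℝ)| ^ m := by
        calc (2:ℝ) ^ ((j:ℝ) * s) = (2:ℝ) ^ ((j:ℝ) * (s - m)) * ((2:ℝ) ^ j) ^ m := by
              rw [← pow_mul, ← Real.rpow_natCast 2 (j * m), ← Real.rpow_add (by norm_num)]
              congr 1; push_cast; ring
          _ ≤ _ := by gcongr
      calc a n ≤ ‖fourierCoeffR f n‖ *
            ((2:ℝ) ^ s * ((2:ℝ) ^ ((j:ℝ) * (s - m)) * |(n:ℝ)| ^ m)) := by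
            simp only [hadef]
            refine mul_le_mul_of_nonneg_left (e1.trans ?_) (norm_nonneg _)
            exact mul_le_mul_of_nonneg_left e2 (by positivity)
        _ = _ := by ring
    refine (Finset.sum_le_sum hterm).trans ?_
    rw [← Finset.mul_sum]
    refine (mul_le_mul_of_nonneg_left (hblock j B hBj) (by positivity)).trans (le_of_eq ?_)
    have e : r ^ j = (2:ℝ) ^ ((j:ℝ) * (s - m)) * (2:ℝ) ^ ((j:ℝ) * (1/2 - (σ - m))) := by
      rw [hr, ← Real.rpow_natCast, ← Real.rpow_mul (by norm_num), ← Real.rpow_add (by norm_num)]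
      congr 1; rw [hσ]; ring
    rw [e]; ring
  refine Real.tsum_le_of_sum_le (fun n => hann n) fun F => ?_
  have hsplit : ∑ n ∈ F, a n ≤ a 0 + ∑ n ∈ F.erase 0, a n := by
    by_cases h0 : (0:ℤ) ∈ F
    · rw [Finset.add_sum_erase F a h0]
    · rw [Finset.erase_eq_of_notMem h0]; linarith [hann 0]
  have ha0' : a 0 ≤ M₁ := by simpa [hadef] using hzero
  set J := (F.sup fun n => Nat.log 2 n.natAbs) + 1 with hJ
  have hmaps : ∀ n ∈ F.erase 0, Nat.log 2 n.natAbs ∈ Finset.range J := by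
    intro n hn
    rw [Finset.mem_range, hJ, Nat.lt_succ_iff]
    exact Finset.le_sup (f := fun n : ℤ => Nat.log 2 n.natAbs) (Finset.mem_of_mem_erase hn)
  have hrest : ∑ n ∈ F.erase 0, a n ≤ (2:ℝ) ^ s * 6 * M₂ * (1 - r)⁻¹ := by
    rw [← Finset.sum_fiberwise_of_maps_to hmaps]
    calc _ ≤ ∑ j ∈ Finset.range J, (2:ℝ) ^ s * 6 * M₂ * r ^ j := by
          refine Finset.sum_le_sum fun j _ => hB j _ ?_
          intro n hn
          rw [Finset.mem_filter, Finset.mem_erase] at hn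
          obtain ⟨⟨hn0, _⟩, rfl⟩ := hn
          exact ⟨Nat.pow_log_le_self 2 (by simpa using hn0),
            Nat.lt_pow_succ_log_self (by norm_num) _⟩
      _ ≤ _ := by
          rw [← Finset.mul_sum]
          refine mul_le_mul_of_nonneg_left ?_ (by positivity)
          rw [← tsum_geometric_of_lt_one hr0.le hr1]
          exact (summable_geometric_of_lt_one hr0.le hr1).sum_le_tsum _ (fun _ _ => by positivity)
  have hC : 0 ≤ (2:ℝ) ^ s * 6 / (1 - r) := by positivity
  have e : (2:ℝ) ^ s * 6 * M₂ * (1 - r)⁻¹ = (2:ℝ) ^ s * 6 / (1 - r) * M₂ := by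
    rw [div_eq_mul_inv]; ring
  rw [e] at hrest
  have := mul_nonneg hC hM1
  nlinarith
end

section
/- Let s ≥ 0 be real and E ⊂ 𝕋 a closed set. Suppose every f ∈ Λ_s(𝕋) (the s-Hölder class on 𝕋) can be written f = g + h where g ∈ Λ_s^+(𝕋) (i.e. g ∈ Λ_s(𝕋) with ĝ(n) = 0 for n < 0) and h ∈ Λ_s(𝕋) vanishes together with its derivatives up to order [s] on E (i.e. the canonical map Λ_s^+(𝕋)/N_s^+(E) → Λ_s(𝕋)/N_s(E) is onto). Let X be a Banach space and Ψ : Λ_s^+(𝕋) → B(X) a continuous algebra homomorphism with Ψ(id) = T invertible in B(X), Ψ(1) = I, and N_s^+(E) ⊆ ker Ψ. Then for all n ≥ 0, ‖T^{-n}‖ ≤ C (1+n)^s, where C = ‖Ψ̃ ∘ i^{-1}‖ with Ψ̃ the induced map on the quotient and i the canonical bijection. -/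
open Real

/-- Membership in the Hölder class `Λ_s(𝕋)`, for functions presented as `2π`-periodic
functions on `ℝ`. -/
def memLambda (s : ℝ) (f : ℝ → ℂ) : Prop :=
  Function.Periodic f (2 * Real.pi) ∧ ContDiff ℝ (⌊s⌋₊ : ℕ) f ∧
    ∃ M : ℝ, ∀ t t' : ℝ, ‖iteratedDeriv ⌊s⌋₊ f t - iteratedDeriv ⌊s⌋₊ f t'‖ ≤
      M * ‖Complex.exp (t * Complex.I) - Complex.exp (t' * Complex.I)‖ ^ (s - (⌊s⌋₊ : ℝ))

/-- Membership in the analytic subalgebra `Λ_s^+(𝕋)`. -/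
def memLambdaPlus (s : ℝ) (f : ℝ → ℂ) : Prop :=
  memLambda s f ∧ ∀ n : ℤ, n < 0 → fourierCoeffR f n = 0

/-- The norm of `Λ_s(𝕋)`. -/
noncomputable def lambdaNorm (s : ℝ) (f : ℝ → ℂ) : ℝ :=
  (∑ k ∈ Finset.range (⌊s⌋₊ + 1), sSup {x : ℝ | ∃ t : ℝ, x = ‖iteratedDeriv k f t‖}) +
    sSup {x : ℝ | ∃ t t' : ℝ,
      Complex.exp (t * Complex.I) ≠ Complex.exp (t' * Complex.I) ∧
      x = ‖iteratedDeriv ⌊s⌋₊ f t - iteratedDeriv ⌊s⌋₊ f t'‖ /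
        ‖Complex.exp (t * Complex.I) - Complex.exp (t' * Complex.I)‖ ^ (s - (⌊s⌋₊ : ℝ))}

/-- `f` vanishes on `E` together with its derivatives up to order `[s]`. -/
def vanishesOn (s : ℝ) (E : Set ℂ) (f : ℝ → ℂ) : Prop :=
  ∀ k ≤ ⌊s⌋₊, ∀ t : ℝ, Complex.exp (t * Complex.I) ∈ E → iteratedDeriv k f t = 0

lemma chord_aux (t t' : ℝ) : ∃ k : ℤ, |t - t' - k * (2 * Real.pi)| ≤
    Real.pi / 2 * ‖Complex.exp (t * Complex.I) - Complex.exp (t' * Complex.I)‖ := by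
  have hp := Real.pi_pos
  have h2 : (0:ℝ) < 2 * Real.pi := by positivity
  set r := toIocMod h2 (-Real.pi) (t - t') with hr
  have hmem := toIocMod_mem_Ioc h2 (-Real.pi) (t - t')
  refine ⟨toIocDiv h2 (-Real.pi) (t - t'), ?_⟩
  have e1 : t - t' - (toIocDiv h2 (-Real.pi) (t - t') : ℤ) * (2 * Real.pi) = r := by
    rw [hr, toIocMod, zsmul_eq_mul]
  rw [e1]
  have hrabs : |r| ≤ Real.pi := by
    rw [abs_le]; constructor <;> linarith [hmem.1, hmem.2]
  have e2 : ‖Complex.exp (t * Complex.I) - Complex.exp (t' * Complex.I)‖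
      = ‖Complex.exp (Complex.I * r) - 1‖ := by
    have e3 : Complex.exp (Complex.I * r) = Complex.exp ((t - t') * Complex.I) := by
      rw [Complex.exp_eq_exp_iff_exists_int]
      refine ⟨-toIocDiv h2 (-Real.pi) (t - t'), ?_⟩
      rw [← e1]; push_cast; ring
    have e4 : Complex.exp (t * Complex.I) - Complex.exp (t' * Complex.I)
        = Complex.exp (t' * Complex.I) * (Complex.exp (Complex.I * r) - 1) := by
      rw [e3, mul_sub, ← Complex.exp_add]; ring_nf
    rw [e4, norm_mul, Complex.norm_exp_ofReal_mul_I, one_mul]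
  rw [e2, Complex.norm_exp_I_mul_ofReal_sub_one, norm_mul, Real.norm_eq_abs, Real.norm_eq_abs]
  have h5 := Real.mul_abs_le_abs_sin (x := r / 2) (by rw [abs_div, abs_two]; linarith)
  rw [abs_div, abs_two] at h5
  rw [abs_two]
  have h6 : Real.pi / 2 * (2 * (2 / Real.pi * (|r| / 2))) = |r| := by field_simp
  refine h6.symm.trans_le ?_
  gcongr

lemma lip_aux {F : ℝ → ℂ} (hF : Function.Periodic F (2 * Real.pi)) (hd : Differentiable ℝ F)
    {L : ℝ} (hL : ∀ t, ‖deriv F t‖ ≤ L) (t t' : ℝ) :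
    ‖F t - F t'‖ ≤ L * (Real.pi / 2 * ‖Complex.exp (t * Complex.I) - Complex.exp (t' * Complex.I)‖) := by
  obtain ⟨k, hk⟩ := chord_aux t t'
  have e : F t = F (t - k * (2 * Real.pi)) := (hF.sub_int_mul_eq k).symm
  have h0 : 0 ≤ L := (norm_nonneg _).trans (hL 0)
  rw [e]
  refine (Convex.norm_image_sub_le_of_norm_deriv_le (s := Set.univ) (fun x _ => hd x)
    (fun x _ => hL x) convex_univ (Set.mem_univ t') (Set.mem_univ _)).trans ?_
  rw [Real.norm_eq_abs]
  refine mul_le_mul_of_nonneg_left (le_trans (le_of_eq ?_) hk) h0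
  congr 1; ring

lemma chord_le_two (t t' : ℝ) : ‖Complex.exp (t * Complex.I) - Complex.exp (t' * Complex.I)‖ ≤ 2 := by
  refine (norm_sub_le _ _).trans ?_
  rw [Complex.norm_exp_ofReal_mul_I, Complex.norm_exp_ofReal_mul_I]; norm_num

lemma per_iter {f : ℝ → ℂ} (hf : Function.Periodic f (2 * Real.pi)) (k : ℕ) :
    Function.Periodic (iteratedDeriv k f) (2 * Real.pi) := by
  intro t
  have h := iteratedDeriv_comp_add_const (𝕜 := ℝ) k f (2 * Real.pi)
  have h2 : (fun z => f (z + 2 * Real.pi)) = f := funext hf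
  rw [h2] at h
  exact (congrFun h t).symm

lemma per_bdd {F : ℝ → ℂ} (hF : Function.Periodic F (2 * Real.pi)) (hc : Continuous F) :
    ∃ B : ℝ, 0 ≤ B ∧ ∀ t, ‖F t‖ ≤ B := by
  have h := hF.isBounded_of_continuous (by positivity) hc
  obtain ⟨B, hB⟩ := h.exists_norm_le
  have : ∀ t, ‖F t‖ ≤ B := fun t => hB _ ⟨t, rfl⟩
  exact ⟨B, (norm_nonneg _).trans (this 0), this⟩

/-- bounded and Hölder of order `a` in the chordal distance -/
def HolB (a : ℝ) (F : ℝ → ℂ) : Prop :=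
  (∃ B : ℝ, 0 ≤ B ∧ ∀ t, ‖F t‖ ≤ B) ∧ ∃ M : ℝ, 0 ≤ M ∧ ∀ t t' : ℝ, ‖F t - F t'‖ ≤
    M * ‖Complex.exp (t * Complex.I) - Complex.exp (t' * Complex.I)‖ ^ a

lemma HolB.add {a : ℝ} {F G : ℝ → ℂ} (hF : HolB a F) (hG : HolB a G) :
    HolB a (fun t => F t + G t) := by
  obtain ⟨⟨B, hB0, hB⟩, M, hM0, hM⟩ := hF
  obtain ⟨⟨B', hB0', hB'⟩, M', hM0', hM'⟩ := hG
  refine ⟨⟨B + B', by positivity, fun t => (norm_add_le _ _).trans (add_le_add (hB t) (hB' t))⟩,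
    M + M', by positivity, fun t t' => ?_⟩
  rw [add_mul, add_sub_add_comm]
  exact (norm_add_le _ _).trans (add_le_add (hM t t') (hM' t t'))

lemma HolB.mul {a : ℝ} {F G : ℝ → ℂ} (hF : HolB a F) (hG : HolB a G) :
    HolB a (fun t => F t * G t) := by
  obtain ⟨⟨B, hB0, hB⟩, M, hM0, hM⟩ := hF
  obtain ⟨⟨B', hB0', hB'⟩, M', hM0', hM'⟩ := hG
  refine ⟨⟨B * B', by positivity, fun t => ?_⟩,
    B * M' + M * B', by positivity, fun t t' => ?_⟩
  · rw [norm_mul]; exact mul_le_mul (hB t) (hB' t) (norm_nonneg _) hB0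
  · have e : F t * G t - F t' * G t' = F t * (G t - G t') + (F t - F t') * G t' := by ring
    rw [e]
    refine (norm_add_le _ _).trans ?_
    rw [norm_mul, norm_mul]
    have h1 := mul_le_mul (hB t) (hM' t t') (norm_nonneg _) hB0
    have h2 := mul_le_mul (hM t t') (hB' t') (norm_nonneg _) (by positivity)
    linarith

lemma HolB.const (a : ℝ) (c : ℂ) : HolB a (fun _ => c) :=
  ⟨⟨‖c‖, norm_nonneg _, fun _ => le_rfl⟩, 0, le_rfl, fun t t' => by simp⟩

lemma HolB.sum {a : ℝ} {ι : Type} (S : Finset ι) (F : ι → ℝ → ℂ) (h : ∀ i ∈ S, HolB a (F i)) :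
    HolB a (fun t => ∑ i ∈ S, F i t) := by
  classical
  induction S using Finset.induction_on with
  | empty => simpa using HolB.const a 0
  | insert i S hi ih =>
    simp only [Finset.sum_insert hi]
    exact (h i (by simp)).add (ih fun j hj => h j (by simp [hj]))

lemma HolB.of_lip {a : ℝ} (ha0 : 0 ≤ a) (ha : a ≤ 1) {F : ℝ → ℂ}
    (hF : Function.Periodic F (2 * Real.pi)) (hd : ContDiff ℝ 1 F) : HolB a F := by
  refine ⟨per_bdd hF hd.continuous, ?_⟩
  have hp1 : Function.Periodic (deriv F) (2 * Real.pi) := by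
    simpa [iteratedDeriv_one] using per_iter hF 1
  obtain ⟨L, hL0, hL⟩ := per_bdd hp1 (hd.continuous_deriv (by norm_num))
  refine ⟨L * (Real.pi / 2) * 2, by positivity, fun t t' => ?_⟩
  refine (lip_aux hF (hd.differentiable (by norm_num)) hL t t').trans ?_
  set d := ‖Complex.exp (t * Complex.I) - Complex.exp (t' * Complex.I)‖
  have hd0 : 0 ≤ d := norm_nonneg _
  have hd2 : d ≤ 2 := chord_le_two t t'
  have : d ≤ 2 * d ^ a := by
    rcases le_total d 1 with h | h
    · have : d ≤ d ^ a := by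
        rcases hd0.eq_or_lt with h0 | h0
        · rw [← h0]; positivity
        · simpa using Real.rpow_le_rpow_of_exponent_ge h0 h ha
      nlinarith [Real.rpow_nonneg hd0 a]
    · have := Real.one_le_rpow h ha0
      linarith
  have hLp : 0 ≤ L * (Real.pi / 2) := by positivity
  nlinarith [mul_le_mul_of_nonneg_left this hLp]

lemma e_per : Function.Periodic (fun t : ℝ => Complex.exp (t * Complex.I)) (2 * Real.pi) := by
  intro t
  have := Complex.exp_periodic (t * Complex.I)
  simp only
  push_cast
  rw [add_mul]; exact this

lemma e_smooth (c : ℂ) {n : WithTop ℕ∞} : ContDiff ℝ n (fun t : ℝ => Complex.exp (c * t)) := by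
  have : ContDiff ℝ n (fun t : ℝ => (t : ℂ)) := Complex.ofRealCLM.contDiff
  exact (contDiff_const.mul this).cexp

lemma e_smooth' {n : WithTop ℕ∞} : ContDiff ℝ n (fun t : ℝ => Complex.exp (t * Complex.I)) := by
  simpa [mul_comm] using e_smooth Complex.I (n := n)

lemma frac_bounds {s : ℝ} (hs : 0 ≤ s) : 0 ≤ s - (⌊s⌋₊ : ℝ) ∧ s - (⌊s⌋₊ : ℝ) ≤ 1 :=
  ⟨by linarith [Nat.floor_le hs], by linarith [Nat.lt_floor_add_one s]⟩

lemma memLambda.holB {s : ℝ} (hs : 0 ≤ s) {f : ℝ → ℂ} (hf : memLambda s f) {k : ℕ}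
    (hk : k ≤ ⌊s⌋₊) : HolB (s - (⌊s⌋₊ : ℝ)) (iteratedDeriv k f) := by
  obtain ⟨hp, hc, M, hM⟩ := hf
  rcases hk.eq_or_lt with rfl | hlt
  · refine ⟨per_bdd (per_iter hp _) (hc.continuous_iteratedDeriv _ le_rfl), |M|, abs_nonneg _,
      fun t t' => (hM t t').trans ?_⟩
    gcongr
    exact le_abs_self M
  · refine HolB.of_lip (frac_bounds hs).1 (frac_bounds hs).2 (per_iter hp k) ?_
    rw [contDiff_one_iff_deriv, ← iteratedDeriv_succ]
    exact ⟨hc.differentiable_iteratedDeriv k (by exact_mod_cast hlt),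
      hc.continuous_iteratedDeriv (k+1) (by exact_mod_cast hlt)⟩

lemma memLambda.emul {s : ℝ} (hs : 0 ≤ s) {f : ℝ → ℂ} (hf : memLambda s f) :
    memLambda s ((fun t : ℝ => Complex.exp (t * Complex.I)) * f) := by
  refine ⟨e_per.mul hf.1, e_smooth'.mul hf.2.1, ?_⟩
  have e : iteratedDeriv ⌊s⌋₊ ((fun t : ℝ => Complex.exp (t * Complex.I)) * f) = fun t =>
      ∑ i ∈ Finset.range (⌊s⌋₊ + 1), ((⌊s⌋₊.choose i : ℕ) : ℂ) *
        iteratedDeriv i (fun t : ℝ => Complex.exp (t * Complex.I)) t *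
        iteratedDeriv (⌊s⌋₊ - i) f t := by
    funext t
    exact iteratedDeriv_mul e_smooth'.contDiffAt hf.2.1.contDiffAt
  have H : HolB (s - (⌊s⌋₊ : ℝ))
      (iteratedDeriv ⌊s⌋₊ ((fun t : ℝ => Complex.exp (t * Complex.I)) * f)) := by
    rw [e]
    refine HolB.sum _ _ fun i _ => ((HolB.const _ _).mul ?_).mul (hf.holB hs (Nat.sub_le _ _))
    refine HolB.of_lip (frac_bounds hs).1 (frac_bounds hs).2 (per_iter e_per i) ?_
    rw [contDiff_one_iff_deriv, ← iteratedDeriv_succ]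
    exact ⟨(e_smooth' (n := (i + 1 : ℕ))).differentiable_iteratedDeriv i (by exact_mod_cast i.lt_succ_self),
      (e_smooth' (n := (i + 1 : ℕ))).continuous_iteratedDeriv (i+1) le_rfl⟩
  obtain ⟨_, M, _, hM⟩ := H
  exact ⟨M, hM⟩

lemma vanishesOn.emul {s : ℝ} {E : Set ℂ} {f : ℝ → ℂ} (hf : memLambda s f)
    (hv : vanishesOn s E f) : vanishesOn s E ((fun t : ℝ => Complex.exp (t * Complex.I)) * f) := by
  intro k hk t ht
  have hc : ContDiff ℝ (k : ℕ) f := hf.2.1.of_le (by exact_mod_cast hk)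
  rw [iteratedDeriv_mul e_smooth'.contDiffAt hc.contDiffAt]
  refine Finset.sum_eq_zero fun i _ => ?_
  rw [hv (k - i) ((Nat.sub_le _ _).trans hk) t ht, mul_zero]

lemma four_emul (f : ℝ → ℂ) (n : ℤ) :
    fourierCoeffR ((fun t : ℝ => Complex.exp (t * Complex.I)) * f) n = fourierCoeffR f (n - 1) := by
  unfold fourierCoeffR
  congr 1
  refine intervalIntegral.integral_congr fun t _ => ?_
  simp only [Pi.mul_apply]
  rw [mul_comm (Complex.exp _) (f t), mul_assoc, ← Complex.exp_add]
  congr 2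
  push_cast; ring

lemma four_add {f g : ℝ → ℂ} (hf : Continuous f) (hg : Continuous g) (n : ℤ) :
    fourierCoeffR (f + g) n = fourierCoeffR f n + fourierCoeffR g n := by
  unfold fourierCoeffR
  rw [← mul_add, ← intervalIntegral.integral_add]
  · congr 1
    refine intervalIntegral.integral_congr fun t _ => ?_
    simp only [Pi.add_apply]; ring
  · exact Continuous.intervalIntegrable (by fun_prop) _ _
  · exact Continuous.intervalIntegrable (by fun_prop) _ _

lemma four_one {n : ℤ} (hn : n < 0) : fourierCoeffR (fun _ => 1) n = 0 := by
  unfold fourierCoeffR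
  have hc : (-(n:ℂ) * Complex.I) ≠ 0 := by
    simp [hn.ne]
  have e : ∀ t : ℝ, (1:ℂ) * Complex.exp (-(n : ℂ) * t * Complex.I)
      = Complex.exp ((-(n:ℂ) * Complex.I) * t) := by
    intro t; rw [one_mul]; ring_nf
  simp only [e]
  rw [integral_exp_mul_complex hc]
  have : Complex.exp ((-(n:ℂ) * Complex.I) * ((2 * Real.pi : ℝ) : ℂ)) = 1 := by
    rw [Complex.exp_eq_one_iff]
    exact ⟨-n, by push_cast; ring⟩
  rw [this]; simp

lemma memLambdaPlus.emul {s : ℝ} (hs : 0 ≤ s) {f : ℝ → ℂ} (hf : memLambdaPlus s f) :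
    memLambdaPlus s ((fun t : ℝ => Complex.exp (t * Complex.I)) * f) :=
  ⟨hf.1.emul hs, fun n hn => by rw [four_emul]; exact hf.2 _ (by omega)⟩

lemma one_mem (s : ℝ) : memLambdaPlus s (fun _ => 1) := by
  refine ⟨⟨fun _ => rfl, contDiff_const, 0, fun t t' => ?_⟩, fun n hn => four_one hn⟩
  simp [iteratedDeriv_const]

lemma e_mem {s : ℝ} (hs : 0 ≤ s) : memLambdaPlus s (fun t : ℝ => Complex.exp (t * Complex.I)) := by
  have := (one_mem s).emul hs
  convert this using 1
  funext t; simp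

open scoped BoundedContinuousFunction in
/-- ambient Banach space of jets -/
abbrev JetW (m : ℕ) : Type := (Fin (m + 1) → (ℝ →ᵇ ℂ)) × (lp (fun _ : ℝ × ℝ => ℂ) ⊤)

lemma four_cont (n : ℤ) : Continuous (fun u : BoundedContinuousFunction ℝ ℂ => fourierCoeffR u n) := by
  unfold fourierCoeffR
  refine continuous_const.mul ?_
  refine intervalIntegral.continuous_parametric_intervalIntegral_of_continuous ?_ continuous_const
  simp only [Function.uncurry_def]
  have h1 : Continuous fun p : BoundedContinuousFunction ℝ ℂ × ℝ => p.1 p.2 := by fun_prop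
  fun_prop

lemma int_cont (t : ℝ) : Continuous (fun u : BoundedContinuousFunction ℝ ℂ => ∫ x in (0:ℝ)..t, u x) := by
  refine intervalIntegral.continuous_parametric_intervalIntegral_of_continuous ?_ continuous_const
  simp only [Function.uncurry_def]
  fun_prop

/-- jets of functions in `Λ_s` -/
def JetV (s : ℝ) : Submodule ℂ (JetW ⌊s⌋₊) where
  carrier := {v | (∀ t, v.1 0 (t + 2 * Real.pi) = v.1 0 t) ∧
    (∀ i : Fin ⌊s⌋₊, ∀ t, ∫ x in (0:ℝ)..t, v.1 i.succ x = v.1 i.castSucc t - v.1 i.castSucc 0) ∧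
    ∀ p : ℝ × ℝ, v.1 (Fin.last _) p.1 - v.1 (Fin.last _) p.2 = v.2 p *
      ((‖Complex.exp (p.1 * Complex.I) - Complex.exp (p.2 * Complex.I)‖ ^ (s - (⌊s⌋₊ : ℝ)) : ℝ) : ℂ)}
  zero_mem' := by
    refine ⟨fun t => by simp, fun i t => by simp, fun p => by simp⟩
  add_mem' := by
    rintro a b ⟨h1, h2, h3⟩ ⟨h1', h2', h3'⟩
    refine ⟨fun t => by simp [h1, h1'], fun i t => ?_, fun p => ?_⟩
    · have : ∫ x in (0:ℝ)..t, (a + b).1 i.succ x =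
          (∫ x in (0:ℝ)..t, a.1 i.succ x) + ∫ x in (0:ℝ)..t, b.1 i.succ x :=
        intervalIntegral.integral_add ((a.1 i.succ).continuous.intervalIntegrable _ _)
          ((b.1 i.succ).continuous.intervalIntegrable _ _)
      rw [this, h2, h2']
      simp only [Prod.fst_add, Pi.add_apply, BoundedContinuousFunction.add_apply]; ring
    · have e1 := h3 p
      have e2 := h3' p
      simp only [Prod.fst_add, Prod.snd_add, Pi.add_apply, BoundedContinuousFunction.add_apply,
        lp.coeFn_add] at *
      rw [add_mul, ← e1, ← e2]; ring
  smul_mem' := by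
    rintro c a ⟨h1, h2, h3⟩
    refine ⟨fun t => by simp [h1], fun i t => ?_, fun p => ?_⟩
    · have : ∫ x in (0:ℝ)..t, (c • a).1 i.succ x = c * ∫ x in (0:ℝ)..t, a.1 i.succ x :=
        intervalIntegral.integral_const_mul _ _
      rw [this, h2]
      simp only [Prod.smul_fst, Pi.smul_apply, BoundedContinuousFunction.smul_apply, smul_eq_mul]; ring
    · have e1 := h3 p
      simp only [Prod.smul_fst, Prod.smul_snd, Pi.smul_apply, BoundedContinuousFunction.smul_apply,
        lp.coeFn_smul, smul_eq_mul] at *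
      rw [mul_assoc, ← e1]; ring

lemma JetV_closed (s : ℝ) : IsClosed (JetV s : Set (JetW ⌊s⌋₊)) := by
  have hev : ∀ (i : Fin (⌊s⌋₊ + 1)) (t : ℝ), Continuous fun v : JetW ⌊s⌋₊ => v.1 i t := by
    intro i t; fun_prop
  have hq : ∀ p : ℝ × ℝ, Continuous fun v : JetW ⌊s⌋₊ => v.2 p := by
    intro p
    have h1 : Continuous fun v : lp (fun _ : ℝ × ℝ => ℂ) ⊤ => (v : ∀ _ : ℝ × ℝ, ℂ) :=
      lp.uniformContinuous_coe.continuous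
    exact (continuous_apply p).comp (h1.comp continuous_snd)
  have : (JetV s : Set (JetW ⌊s⌋₊)) = (⋂ t, {v | v.1 0 (t + 2 * Real.pi) = v.1 0 t}) ∩
      ((⋂ i : Fin ⌊s⌋₊, ⋂ t, {v | ∫ x in (0:ℝ)..t, v.1 i.succ x = v.1 i.castSucc t - v.1 i.castSucc 0}) ∩
      ⋂ p : ℝ × ℝ, {v | v.1 (Fin.last _) p.1 - v.1 (Fin.last _) p.2 = v.2 p *
      ((‖Complex.exp (p.1 * Complex.I) - Complex.exp (p.2 * Complex.I)‖ ^ (s - (⌊s⌋₊ : ℝ)) : ℝ) : ℂ)}) := by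
    ext v
    simp only [Set.mem_inter_iff, Set.mem_iInter, Set.mem_setOf_eq]
    rfl
  rw [this]
  refine IsClosed.inter (isClosed_iInter fun t => isClosed_eq (hev _ _) (hev _ _)) (IsClosed.inter
    (isClosed_iInter fun i => isClosed_iInter fun t => isClosed_eq ?_ ((hev _ _).sub (hev _ _)))
    (isClosed_iInter fun p => isClosed_eq ((hev _ _).sub (hev _ _)) ((hq p).mul continuous_const)))
  exact (int_cont t).comp ((continuous_apply i.succ).comp continuous_fst)

lemma JetV_hasDeriv {s : ℝ} {v : JetW ⌊s⌋₊} (hv : v ∈ JetV s) (i : Fin ⌊s⌋₊) (t : ℝ) :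
    HasDerivAt (v.1 i.castSucc) (v.1 i.succ t) t := by
  have h2 := hv.2.1 i
  have e : (v.1 i.castSucc : ℝ → ℂ) = fun t => (∫ x in (0:ℝ)..t, v.1 i.succ x) + v.1 i.castSucc 0 := by
    funext t; rw [h2]; ring
  rw [e]
  exact (intervalIntegral.integral_hasDerivAt_right ((v.1 i.succ).continuous.intervalIntegrable _ _)
    (v.1 i.succ).continuous.aestronglyMeasurable.stronglyMeasurableAtFilter
    (v.1 i.succ).continuous.continuousAt).add_const _

lemma JetV_iter {s : ℝ} {v : JetW ⌊s⌋₊} (hv : v ∈ JetV s) : ∀ (k : ℕ) (hk : k < ⌊s⌋₊ + 1),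
    iteratedDeriv k (v.1 0) = v.1 ⟨k, hk⟩ := by
  intro k
  induction k with
  | zero => intro hk; rw [iteratedDeriv_zero]; rfl
  | succ k ih =>
    intro hk
    rw [iteratedDeriv_succ, ih (by omega)]
    funext t
    exact (JetV_hasDeriv hv ⟨k, by omega⟩ t).deriv

lemma JetV_mem {s : ℝ} {v : JetW ⌊s⌋₊} (hv : v ∈ JetV s) : memLambda s (v.1 0) := by
  refine ⟨hv.1, ?_, ‖v.2‖, fun t t' => ?_⟩
  · rw [contDiff_nat_iff_iteratedDeriv]
    refine ⟨fun k hk => ?_, fun k hk => ?_⟩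
    · rw [JetV_iter hv k (by omega)]; exact (v.1 _).continuous
    · rw [JetV_iter hv k (by omega)]
      exact fun t => (JetV_hasDeriv hv ⟨k, hk⟩ t).differentiableAt
  · rw [JetV_iter hv _ (Nat.lt_succ_self _)]
    have := hv.2.2 (t, t')
    change ‖v.1 (Fin.last _) t - v.1 (Fin.last _) t'‖ ≤ _
    rw [this, norm_mul, Complex.norm_real, Real.norm_of_nonneg (by positivity)]
    gcongr
    exact lp.norm_apply_le_norm (by simp) _ _

lemma JetV_norm {s : ℝ} {v : JetW ⌊s⌋₊} (hv : v ∈ JetV s) :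
    0 ≤ lambdaNorm s (v.1 0) ∧ lambdaNorm s (v.1 0) ≤ ((⌊s⌋₊ : ℝ) + 2) * ‖v‖ := by
  unfold lambdaNorm
  constructor
  · refine add_nonneg (Finset.sum_nonneg fun k _ => Real.sSup_nonneg ?_) (Real.sSup_nonneg ?_)
    · rintro x ⟨t, rfl⟩; positivity
    · rintro x ⟨t, t', _, rfl⟩; positivity
  · have h1 : ∀ k ∈ Finset.range (⌊s⌋₊ + 1),
        sSup {x : ℝ | ∃ t : ℝ, x = ‖iteratedDeriv k (v.1 0) t‖} ≤ ‖v‖ := by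
      intro k hk
      refine Real.sSup_le ?_ (norm_nonneg _)
      rintro x ⟨t, rfl⟩
      rw [JetV_iter hv k (Finset.mem_range.1 hk)]
      exact ((v.1 _).norm_coe_le_norm t).trans ((norm_le_pi_norm v.1 _).trans (norm_fst_le v))
    have h2 := Finset.sum_le_sum h1
    rw [Finset.sum_const, Finset.card_range, nsmul_eq_mul] at h2
    push_cast at h2
    refine (add_le_add h2 (b := _) (d := ‖v‖) (Real.sSup_le ?_ (norm_nonneg _))).trans (le_of_eq (by ring))
    rintro x ⟨t, t', hne, rfl⟩
    have hpos : 0 < ‖Complex.exp (t * Complex.I) - Complex.exp (t' * Complex.I)‖ :=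
      norm_pos_iff.2 (sub_ne_zero.2 hne)
    rw [div_le_iff₀ (by positivity)]
    rw [JetV_iter hv _ (Nat.lt_succ_self _)]
    have := hv.2.2 (t, t')
    change ‖v.1 (Fin.last _) t - v.1 (Fin.last _) t'‖ ≤ _
    rw [this, norm_mul, Complex.norm_real, Real.norm_of_nonneg (by positivity)]
    gcongr
    exact (lp.norm_apply_le_norm (by simp) _ _).trans (norm_snd_le v)

lemma JetV_exists {s : ℝ} {f : ℝ → ℂ} (hp : Function.Periodic f (2 * Real.pi))
    (hc : ContDiff ℝ (⌊s⌋₊ : ℕ) f) {B : ℝ} (hB0 : 0 ≤ B)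
    (hB : ∀ k ≤ ⌊s⌋₊, ∀ t, ‖iteratedDeriv k f t‖ ≤ B)
    (hH : ∀ t t' : ℝ, ‖iteratedDeriv ⌊s⌋₊ f t - iteratedDeriv ⌊s⌋₊ f t'‖ ≤
      B * ‖Complex.exp (t * Complex.I) - Complex.exp (t' * Complex.I)‖ ^ (s - (⌊s⌋₊ : ℝ))) :
    ∃ v ∈ JetV s, (v.1 0 : ℝ → ℂ) = f ∧ ‖v‖ ≤ B := by
  let u : Fin (⌊s⌋₊ + 1) → BoundedContinuousFunction ℝ ℂ := fun i =>
    BoundedContinuousFunction.ofNormedAddCommGroup (iteratedDeriv i f)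
      (hc.continuous_iteratedDeriv i (by exact_mod_cast Nat.lt_succ_iff.1 i.2)) B
      (hB i (Nat.lt_succ_iff.1 i.2))
  let q : ℝ × ℝ → ℂ := fun p => (iteratedDeriv ⌊s⌋₊ f p.1 - iteratedDeriv ⌊s⌋₊ f p.2) /
    ((‖Complex.exp (p.1 * Complex.I) - Complex.exp (p.2 * Complex.I)‖ ^ (s - (⌊s⌋₊ : ℝ)) : ℝ) : ℂ)
  have hqB : ∀ p, ‖q p‖ ≤ B := by
    intro p
    simp only [q]
    rw [norm_div, Complex.norm_real, Real.norm_of_nonneg (by positivity)]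
    exact div_le_of_le_mul₀ (by positivity) hB0 (hH _ _)
  have hq : Memℓp q ⊤ := memℓp_infty ⟨B, by rintro _ ⟨p, rfl⟩; exact hqB p⟩
  refine ⟨(u, ⟨q, hq⟩), ⟨fun t => ?_, fun i t => ?_, fun p => ?_⟩, ?_, ?_⟩
  · simp [u, hp t]
  · refine intervalIntegral.integral_eq_sub_of_hasDerivAt (f := iteratedDeriv i f)
      (f' := iteratedDeriv (i + 1) f) (fun x _ => ?_) ((u i.succ).continuous.intervalIntegrable _ _)
    rw [iteratedDeriv_succ]
    exact (hc.differentiable_iteratedDeriv i (by exact_mod_cast i.2) x).hasDerivAt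
  · change iteratedDeriv ⌊s⌋₊ f p.1 - iteratedDeriv ⌊s⌋₊ f p.2 = q p * _
    simp only [q]
    by_cases h0 : ‖Complex.exp (p.1 * Complex.I) - Complex.exp (p.2 * Complex.I)‖ ^ (s - (⌊s⌋₊ : ℝ)) = 0
    · have := hH p.1 p.2
      rw [h0, mul_zero] at this
      rw [h0, norm_le_zero_iff.1 this]; simp
    · rw [div_mul_cancel₀]
      exact_mod_cast h0
  · funext t; simp [u]
  · refine max_le ?_ ?_
    · refine (pi_norm_le_iff_of_nonneg hB0).2 fun i => ?_
      exact BoundedContinuousFunction.norm_ofNormedAddCommGroup_le _ hB0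
        (hB i (Nat.lt_succ_iff.1 i.2))
    · exact lp.norm_le_of_forall_le hB0 hqB

lemma JetV_exists' {s : ℝ} (hs : 0 ≤ s) {f : ℝ → ℂ} (hf : memLambda s f) :
    ∃ v ∈ JetV s, (v.1 0 : ℝ → ℂ) = f := by
  have h : ∀ k : Fin (⌊s⌋₊ + 1), ∃ B : ℝ, 0 ≤ B ∧ ∀ t, ‖iteratedDeriv k f t‖ ≤ B := fun k =>
    (hf.holB hs (Nat.lt_succ_iff.1 k.2)).1
  choose B hB0 hB using h
  obtain ⟨_, M, hM0, hM⟩ := hf.holB hs le_rfl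
  have hS : 0 ≤ ∑ k, B k := Finset.sum_nonneg fun k _ => hB0 k
  obtain ⟨v, hv, e, _⟩ := JetV_exists (s := s) hf.1 hf.2.1 (B := (∑ k, B k) + M) (by positivity)
    (fun k hk t => (hB ⟨k, Nat.lt_succ_iff.2 hk⟩ t).trans (by
      have := Finset.single_le_sum (f := B) (fun k _ => hB0 k) (Finset.mem_univ ⟨k, Nat.lt_succ_iff.2 hk⟩)
      linarith))
    (fun t t' => (hM t t').trans (by gcongr; linarith))
  exact ⟨v, hv, e⟩

lemma neg_pow_bound {s : ℝ} (hs : 0 ≤ s) (n : ℕ) : ∃ v ∈ JetV s,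
    (v.1 0 : ℝ → ℂ) = (fun t : ℝ => Complex.exp (-(n : ℂ) * Complex.I * t)) ∧
    ‖v‖ ≤ 4 * (1 + (n : ℝ)) ^ s := by
  set c : ℂ := -(n : ℂ) * Complex.I with hc
  have hcn : ‖c‖ = n := by simp [hc]
  have hder : ∀ (k : ℕ) , iteratedDeriv k (fun t : ℝ => Complex.exp (c * t)) =
      fun t : ℝ => c ^ k * Complex.exp (c * t) := by
    intro k
    induction k with
    | zero => simp
    | succ k ih =>
      rw [iteratedDeriv_succ, ih]
      funext t
      have h1 : HasDerivAt (fun t : ℝ => c * (t : ℂ)) (c * 1) t :=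
        (Complex.ofRealCLM.hasDerivAt (x := t)).const_mul c
      have h2 := (h1.cexp.const_mul (c ^ k)).deriv
      rw [h2]; ring
  have hn1 : ∀ t : ℝ, ‖Complex.exp (c * t)‖ = 1 := by
    intro t
    have : c * t = ((-(n:ℝ) * t : ℝ) : ℂ) * Complex.I := by rw [hc]; push_cast; ring
    rw [this, Complex.norm_exp_ofReal_mul_I]
  have hper : Function.Periodic (fun t : ℝ => Complex.exp (c * t)) (2 * Real.pi) := by
    intro t
    simp only
    rw [Complex.exp_eq_exp_iff_exists_int]
    exact ⟨-n, by rw [hc]; push_cast; ring⟩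
  have hN : (1:ℝ) ≤ 1 + n := by linarith [n.cast_nonneg (α := ℝ)]
  have hpos : 0 ≤ (1 + (n : ℝ)) ^ s := by positivity
  refine JetV_exists hper (e_smooth c) (by positivity) (fun k hk t => ?_) (fun t t' => ?_)
  · rw [hder]
    simp only
    rw [norm_mul, hn1, mul_one, norm_pow, hcn]
    have h1 : (n:ℝ) ^ k ≤ (1 + (n:ℝ)) ^ k := by gcongr; linarith
    have h2 : (1 + (n:ℝ)) ^ (k : ℝ) ≤ (1 + (n : ℝ)) ^ s :=
      Real.rpow_le_rpow_of_exponent_le hN ((Nat.cast_le.2 hk).trans (Nat.floor_le hs))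
    rw [Real.rpow_natCast] at h2
    linarith
  · rw [hder]
    simp only
    rw [← mul_sub, norm_mul, norm_pow, hcn]
    set a := s - (⌊s⌋₊ : ℝ) with ha
    obtain ⟨ha0, ha1⟩ := frac_bounds hs
    rw [← ha] at ha0 ha1
    have hlip := lip_aux hper ((e_smooth c (n := 1)).differentiable (by norm_num)) (L := n) (fun t => by
      have := congrFun (hder 1) t
      rw [iteratedDeriv_one] at this
      rw [this]
      rw [norm_mul, hn1, pow_one, hcn, mul_one]) t t'
    set d := ‖Complex.exp (t * Complex.I) - Complex.exp (t' * Complex.I)‖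
    have hd0 : 0 ≤ d := norm_nonneg _
    set y := ‖Complex.exp (c * t) - Complex.exp (c * t')‖
    have hy2 : y ≤ 2 := (norm_sub_le _ _).trans (by rw [hn1, hn1]; norm_num)
    have hyx : y ≤ 2 * ((1 + n) * d) := by
      refine hlip.trans ?_
      have : Real.pi / 2 ≤ 2 := by linarith [Real.pi_le_four]
      calc (n:ℝ) * (Real.pi / 2 * d) ≤ (1 + n) * (2 * d) := by gcongr; linarith
        _ = _ := by ring
    set x := (1 + (n:ℝ)) * d with hx
    have hx0 : 0 ≤ x := by positivity
    have hyxa : y ≤ 2 * x ^ a := by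
      rcases le_total x 1 with h | h
      · have : x ≤ x ^ a := by
          rcases hx0.eq_or_lt with h0 | h0
          · rw [← h0]; positivity
          · simpa using Real.rpow_le_rpow_of_exponent_ge h0 h ha1
        linarith
      · have := Real.one_le_rpow h ha0
        linarith
    rw [hx, Real.mul_rpow (by positivity) hd0] at hyxa
    have hsplit : (1 + (n:ℝ)) ^ s = (1 + (n:ℝ)) ^ ⌊s⌋₊ * (1 + (n:ℝ)) ^ a := by
      rw [← Real.rpow_natCast, ← Real.rpow_add (by positivity), ha]; congr 1; ring
    rw [hsplit]
    have h1 : (n:ℝ) ^ ⌊s⌋₊ ≤ (1 + (n:ℝ)) ^ ⌊s⌋₊ := by gcongr; linarith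
    have h2 := mul_le_mul h1 hyxa (norm_nonneg _) (by positivity)
    have h3 : 0 ≤ (1 + (n:ℝ)) ^ ⌊s⌋₊ * ((1 + (n:ℝ)) ^ a * d ^ a) := by positivity
    nlinarith

/-- pairs (analytic, vanishing on `E`) -/
def PairP (s : ℝ) (E : Set ℂ) : Submodule ℂ (JetV s × JetV s) where
  carrier := {x | (∀ n : ℤ, n < 0 → fourierCoeffR (x.1.1.1 0) n = 0) ∧
    ∀ (i : Fin (⌊s⌋₊ + 1)) (t : ℝ), Complex.exp (t * Complex.I) ∈ E → x.2.1.1 i t = 0}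
  zero_mem' := ⟨fun n _ => by simp [fourierCoeffR], fun i t _ => by simp⟩
  add_mem' := by
    rintro a b ⟨h1, h2⟩ ⟨h1', h2'⟩
    refine ⟨fun n hn => ?_, fun i t ht => by simp [h2 i t ht, h2' i t ht]⟩
    have := four_add (a.1.1.1 0).continuous (b.1.1.1 0).continuous n
    rw [h1 n hn, h1' n hn, add_zero] at this
    exact this
  smul_mem' := by
    rintro c a ⟨h1, h2⟩
    refine ⟨fun n hn => ?_, fun i t ht => by simp [h2 i t ht]⟩
    have e : fourierCoeffR ((c • a).1.1.1 0) n = c * fourierCoeffR (a.1.1.1 0) n := by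
      unfold fourierCoeffR
      have h : ∫ t in (0:ℝ)..(2 * Real.pi), (c • a).1.1.1 0 t * Complex.exp (-(n : ℂ) * t * Complex.I)
          = c * ∫ t in (0:ℝ)..(2 * Real.pi), a.1.1.1 0 t * Complex.exp (-(n : ℂ) * t * Complex.I) := by
        rw [← intervalIntegral.integral_const_mul]
        refine intervalIntegral.integral_congr fun t _ => ?_
        exact mul_assoc c _ _
      rw [h, mul_left_comm]
    rw [e, h1 n hn, mul_zero]

lemma PairP_closed (s : ℝ) (E : Set ℂ) : IsClosed (PairP s E : Set (JetV s × JetV s)) := by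
  have : (PairP s E : Set (JetV s × JetV s)) =
      (⋂ n : ℤ, ⋂ _ : n < 0, {x | fourierCoeffR (x.1.1.1 0) n = 0}) ∩
      ⋂ (i : Fin (⌊s⌋₊ + 1)), ⋂ (t : ℝ), ⋂ (_ : Complex.exp (t * Complex.I) ∈ E),
        {x | x.2.1.1 i t = 0} := by
    ext v
    simp only [Set.mem_inter_iff, Set.mem_iInter, Set.mem_setOf_eq]
    rfl
  rw [this]
  refine IsClosed.inter (isClosed_iInter fun n => isClosed_iInter fun _ => isClosed_eq ?_ continuous_const)
    (isClosed_iInter fun i => isClosed_iInter fun t => isClosed_iInter fun _ =>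
      isClosed_eq (by fun_prop) continuous_const)
  have : Continuous fun x : JetV s × JetV s => x.1.1.1 0 := by fun_prop
  exact (four_cont n).comp this

lemma decomp_bound {s : ℝ} (hs : 0 ≤ s) (E : Set ℂ)
    (honto : ∀ f : ℝ → ℂ, memLambda s f → ∃ g h : ℝ → ℂ,
      memLambdaPlus s g ∧ memLambda s h ∧ vanishesOn s E h ∧ f = g + h) :
    ∃ K > 0, ∀ v ∈ JetV s, ∃ g h : ℝ → ℂ,
      memLambdaPlus s g ∧ memLambda s h ∧ vanishesOn s E h ∧ (v.1 0 : ℝ → ℂ) = g + h ∧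
      0 ≤ lambdaNorm s g ∧ lambdaNorm s g ≤ K * ‖v‖ := by
  have : CompleteSpace (JetV s) := (JetV_closed s).completeSpace_coe
  have : CompleteSpace (PairP s E) := (PairP_closed s E).completeSpace_coe
  let A : PairP s E →L[ℂ] JetV s :=
    (ContinuousLinearMap.fst ℂ (JetV s) (JetV s) + ContinuousLinearMap.snd ℂ (JetV s) (JetV s)).comp
      (PairP s E).subtypeL
  have hA : ∀ x, A x = x.1.1 + x.1.2 := fun x => rfl
  have hsurj : Function.Surjective A := by
    intro v
    obtain ⟨g, h, hg, hh, hv, e⟩ := honto _ (JetV_mem v.2)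
    obtain ⟨a, ha, ea⟩ := JetV_exists' hs hg.1
    have e0 : ((v.1 - a).1 0 : ℝ → ℂ) = h := by
      funext t
      change v.1.1 0 t - a.1 0 t = h t
      rw [e, ea]; simp
    have hb := (JetV s).sub_mem v.2 ha
    refine ⟨⟨(⟨a, ha⟩, ⟨v.1 - a, hb⟩), ⟨fun n hn => ?_, fun i t ht => ?_⟩⟩, ?_⟩
    · change fourierCoeffR (a.1 0) n = 0
      rw [ea]; exact hg.2 n hn
    · change (v.1 - a).1 i t = 0
      have := JetV_iter hb i i.2
      rw [e0] at this
      have h2 := congrFun this t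
      rw [hv i (Nat.lt_succ_iff.1 i.2) t ht] at h2
      exact h2.symm
    · rw [hA]
      apply Subtype.ext
      change a + (v.1 - a) = v.1
      abel
  obtain ⟨C, hC, H⟩ := ContinuousLinearMap.exists_preimage_norm_le (σ := RingHom.id ℂ) (σ' := RingHom.id ℂ) (E := PairP s E) (F := JetV s) A hsurj
  refine ⟨((⌊s⌋₊ : ℝ) + 2) * C, by positivity, fun v hv => ?_⟩
  obtain ⟨x, hx, hxn⟩ := H ⟨v, hv⟩
  obtain ⟨h0, h1⟩ := JetV_norm x.1.1.2
  refine ⟨x.1.1.1.1 0, x.1.2.1.1 0, ⟨JetV_mem x.1.1.2, x.2.1⟩, JetV_mem x.1.2.2, ?_, ?_, h0, h1.trans ?_⟩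
  · intro k hk t ht
    rw [JetV_iter x.1.2.2 k (Nat.lt_succ_iff.2 hk)]
    exact x.2.2 _ t ht
  · have := congrArg Subtype.val hx
    rw [hA] at this
    change x.1.1.1 + x.1.2.1 = v at this
    rw [← this]; rfl
  · rw [mul_assoc]
    have h3 : ‖x.1.1.1‖ ≤ ‖x‖ := norm_fst_le x.1
    have h4 : ‖x‖ ≤ C * ‖v‖ := hxn
    gcongr
    exact h3.trans h4

/-- Abstract functional-calculus bound: if the canonical map
`Λ_s^+(𝕋)/N_s^+(E) → Λ_s(𝕋)/N_s(E)` is onto and `Ψ` is a continuous homomorphism on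
`Λ_s^+(𝕋)` killing `N_s^+(E)` with `Ψ(id) = T` invertible, then `‖T^{-n}‖ = O((1+n)^s)`. -/
theorem stmt11 (s : ℝ) (hs : 0 ≤ s)
    (E : Set ℂ) (hE : IsClosed E) (hEsub : E ⊆ Metric.sphere (0:ℂ) 1) (hEne : E.Nonempty)
    (X : Type) [NormedAddCommGroup X] [NormedSpace ℂ X] [CompleteSpace X] [Nontrivial X]
    (Ψ : (ℝ → ℂ) → (X →L[ℂ] X))
    (hadd : ∀ f g : ℝ → ℂ, memLambdaPlus s f → memLambdaPlus s g → Ψ (f + g) = Ψ f + Ψ g)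
    (hsmul : ∀ (c : ℂ) (f : ℝ → ℂ), memLambdaPlus s f → Ψ (c • f) = c • Ψ f)
    (hmul : ∀ f g : ℝ → ℂ, memLambdaPlus s f → memLambdaPlus s g → Ψ (f * g) = Ψ f * Ψ g)
    (hbdd : ∃ C₀ : ℝ, ∀ f : ℝ → ℂ, memLambdaPlus s f → ‖Ψ f‖ ≤ C₀ * lambdaNorm s f)
    (hone : Ψ (fun _ => 1) = 1)
    (T : (X →L[ℂ] X)ˣ)
    (hT : Ψ (fun t : ℝ => Complex.exp (t * Complex.I)) = (T : X →L[ℂ] X))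
    (hker : ∀ f : ℝ → ℂ, memLambdaPlus s f → vanishesOn s E f → Ψ f = 0)
    (honto : ∀ f : ℝ → ℂ, memLambda s f → ∃ g h : ℝ → ℂ,
      memLambdaPlus s g ∧ memLambda s h ∧ vanishesOn s E h ∧ f = g + h) :
    ∃ C > 0, ∀ n : ℕ, ‖((T⁻¹ : (X →L[ℂ] X)ˣ) : X →L[ℂ] X) ^ n‖ ≤ C * (1 + (n : ℝ)) ^ s := by
  obtain ⟨C₀, hC₀⟩ := hbdd
  obtain ⟨K, hK, H⟩ := decomp_bound hs E honto
  set e : ℝ → ℂ := fun t : ℝ => Complex.exp (t * Complex.I) with he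
  have hpow : ∀ (n : ℕ) (g : ℝ → ℂ), memLambdaPlus s g →
      memLambdaPlus s (e ^ n * g) ∧ Ψ (e ^ n * g) = (T : X →L[ℂ] X) ^ n * Ψ g := by
    intro n g hg
    induction n with
    | zero => simpa using hg
    | succ n ih =>
      rw [pow_succ', mul_assoc]
      refine ⟨ih.1.emul hs, ?_⟩
      rw [hmul _ _ (e_mem hs) ih.1, hT, ih.2, pow_succ', mul_assoc]
  have hvan : ∀ (n : ℕ) (h : ℝ → ℂ), memLambda s h → vanishesOn s E h →
      memLambda s (e ^ n * h) ∧ vanishesOn s E (e ^ n * h) := by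
    intro n h hh hv
    induction n with
    | zero => simpa using ⟨hh, hv⟩
    | succ n ih =>
      rw [pow_succ', mul_assoc]
      exact ⟨ih.1.emul hs, vanishesOn.emul ih.1 ih.2⟩
  refine ⟨|C₀| * (K * 4) + 1, by positivity, fun n => ?_⟩
  obtain ⟨v, hv, ev, hvn⟩ := neg_pow_bound hs n
  obtain ⟨g, h, hg, hh, hvh, hgh, hn0, hn1⟩ := H v hv
  obtain ⟨hF, hΨF⟩ := hpow n g hg
  obtain ⟨hw, hwv⟩ := hvan n h hh hvh
  have hsum : (fun _ => 1 : ℝ → ℂ) = e ^ n * g + e ^ n * h := by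
    rw [← mul_add, ← hgh, ev]
    funext t
    simp only [he, Pi.mul_apply, Pi.pow_apply]
    rw [← Complex.exp_nat_mul, ← Complex.exp_add, eq_comm, Complex.exp_eq_one_iff]
    exact ⟨0, by push_cast; ring⟩
  have hw' : memLambdaPlus s (e ^ n * h) := by
    refine ⟨hw, fun k hk => ?_⟩
    have := four_add hF.1.2.1.continuous hw.2.1.continuous k
    rw [← hsum, four_one hk, hF.2 k hk, zero_add] at this
    exact this.symm
  have h1 : (T : X →L[ℂ] X) ^ n * Ψ g = 1 := by
    rw [← hΨF, ← hone, hsum, hadd _ _ hF hw', hker _ hw' hwv, add_zero]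
  have h2 : ((T⁻¹ : (X →L[ℂ] X)ˣ) : X →L[ℂ] X) ^ n = Ψ g := by
    have h3 : ((T⁻¹ : (X →L[ℂ] X)ˣ) : X →L[ℂ] X) ^ n * (T : X →L[ℂ] X) ^ n = 1 := by
      rw [← Units.val_pow_eq_pow_val, ← Units.val_pow_eq_pow_val, ← Units.val_mul, inv_pow,
        inv_mul_cancel, Units.val_one]
    exact left_inv_eq_right_inv h3 h1
  rw [h2]
  have hp : 0 ≤ (1 + (n:ℝ)) ^ s := by positivity
  calc ‖Ψ g‖ ≤ C₀ * lambdaNorm s g := hC₀ g hg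
    _ ≤ |C₀| * (K * (4 * (1 + (n : ℝ)) ^ s)) := by
      refine mul_le_mul (le_abs_self _) (hn1.trans ?_) hn0 (abs_nonneg _)
      gcongr
    _ ≤ _ := by nlinarith
end
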